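/- The function W(R) := Σ_{k=1}^{∞} P(2k, 2R²) · Q(2k, 2R²) satisfies lim_{R→∞} W(R)/R = 1/√(2π) and lim_{R→0⁺} W(R)/R⁴ = 2. (These are the large- and small-radius asymptotics of the number variance of the infinite symplectic Ginibre ensemble.) -/

import Mathlib

open MeasureTheory Real Filter

/-- The lower incomplete gamma function `γ(n,x) = ∫₀^x t^(n-1) e^(-t) dt`. -/
noncomputable def lowGamma (n x : ℝ) : ℝ := ∫ t in (0:ℝ)..x, t ^ (n - 1) * Real.exp (-t)

/-- The regularized lower incomplete gamma function `P(n,x) = γ(n,x)/Γ(n)`. -/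
noncomputable def regP (n x : ℝ) : ℝ := (Real.Gamma n)⁻¹ * lowGamma n x

/-- The regularized upper incomplete gamma function `Q(n,x) = 1 - P(n,x)`. -/
noncomputable def regQ (n x : ℝ) : ℝ := 1 - regP n x

/-- The number variance of the infinite symplectic Ginibre ensemble in a centred disc
of radius `R`: `W(R) = Σ_{k=1}^∞ P(2k,2R²) Q(2k,2R²)`. -/
noncomputable def varGinSE (R : ℝ) : ℝ :=
  ∑' k : ℕ, regP (2 * k + 2) (2 * R ^ 2) * regQ (2 * k + 2) (2 * R ^ 2)

/-- The Poisson weight `e^(-x) x^n / n!`. -/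
noncomputable def poissonWeight (x : ℝ) (n : ℕ) : ℝ := exp (-x) * (x ^ n / n.factorial)

/-- The Poisson distribution function, summed over the indices below `n`. -/
noncomputable def poissonCDF (x : ℝ) (n : ℕ) : ℝ := ∑ j ∈ Finset.range n, poissonWeight x j

lemma poissonWeight_nonneg {x : ℝ} (hx : 0 ≤ x) (n : ℕ) : 0 ≤ poissonWeight x n := by
  unfold poissonWeight; positivity

lemma continuous_poissonWeight (n : ℕ) : Continuous fun x => poissonWeight x n := by
  unfold poissonWeight; fun_prop

lemma continuous_poissonCDF (n : ℕ) : Continuous fun x => poissonCDF x n :=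
  continuous_finsetSum _ fun j _ => continuous_poissonWeight j

lemma hasSum_poissonWeight (x : ℝ) : HasSum (poissonWeight x) 1 := by
  have h : HasSum (fun n : ℕ => x ^ n / n.factorial) (exp x) := by
    rw [Real.exp_eq_exp_ℝ]
    exact NormedSpace.expSeries_div_hasSum_exp x
  have h' := h.mul_left (exp (-x))
  rwa [← Real.exp_add, neg_add_cancel, Real.exp_zero] at h'

lemma poissonCDF_succ (x : ℝ) (n : ℕ) :
    poissonCDF x (n + 1) = poissonCDF x n + poissonWeight x n :=
  Finset.sum_range_succ _ _

lemma poissonCDF_nonneg {x : ℝ} (hx : 0 ≤ x) (n : ℕ) : 0 ≤ poissonCDF x n :=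
  Finset.sum_nonneg fun j _ => poissonWeight_nonneg hx j

lemma poissonCDF_le_one {x : ℝ} (hx : 0 ≤ x) (n : ℕ) : poissonCDF x n ≤ 1 :=
  sum_le_hasSum _ (fun j _ => poissonWeight_nonneg hx j) (hasSum_poissonWeight x)

lemma tendsto_poissonCDF (x : ℝ) : Tendsto (poissonCDF x) atTop (nhds 1) :=
  (hasSum_poissonWeight x).tendsto_sum_nat

lemma hasDerivAt_poissonCDF (n : ℕ) (x : ℝ) :
    HasDerivAt (fun y => poissonCDF y (n + 1)) (-poissonWeight x n) x := by
  induction n with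
  | zero =>
    simpa [poissonCDF, poissonWeight] using (hasDerivAt_neg x).exp
  | succ n ih =>
    have h : HasDerivAt (fun y => poissonWeight y (n + 1))
        (poissonWeight x n - poissonWeight x (n + 1)) x := by
      have h1 := (hasDerivAt_neg x).exp.mul ((hasDerivAt_pow (n + 1) x).div_const
        ((n + 1).factorial : ℝ))
      refine h1.congr_deriv ?_
      simp only [poissonWeight, Nat.factorial_succ, add_tsub_cancel_right]
      push_cast
      have : (n.factorial : ℝ) ≠ 0 := by positivity
      field_simp
      ring
    simp_rw [poissonCDF_succ _ (n + 1)]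
    exact (ih.add h).congr_deriv (by ring)

lemma poissonCDF_zero_left (n : ℕ) : poissonCDF 0 (n + 1) = 1 := by
  rw [poissonCDF, Finset.sum_range_succ']
  simp [poissonWeight]

lemma integral_poissonWeight (n : ℕ) (x : ℝ) :
    ∫ t in (0:ℝ)..x, poissonWeight t n = 1 - poissonCDF x (n + 1) := by
  rw [intervalIntegral.integral_eq_sub_of_hasDerivAt (f := fun y => - poissonCDF y (n + 1))
    (fun t _ => (hasDerivAt_poissonCDF n t).fun_neg.congr_deriv (neg_neg _))
    ((continuous_poissonWeight n).intervalIntegrable _ _), poissonCDF_zero_left]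
  ring

lemma regP_natCast_succ (n : ℕ) (x : ℝ) : regP (n + 1) x = 1 - poissonCDF x (n + 1) := by
  rw [regP, lowGamma, Real.Gamma_nat_eq_factorial, ← intervalIntegral.integral_const_mul,
    ← integral_poissonWeight]
  refine intervalIntegral.integral_congr fun t _ => ?_
  simp only [add_sub_cancel_right, rpow_natCast, poissonWeight]
  ring

/-- The product `P(n+1,x) Q(n+1,x)`. -/
noncomputable def tailProduct (x : ℝ) (n : ℕ) : ℝ :=
  (1 - poissonCDF x (n + 1)) * poissonCDF x (n + 1)

lemma varGinSE_eq (R : ℝ) : varGinSE R = ∑' k : ℕ, tailProduct (2 * R ^ 2) (2 * k + 1) := by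
  refine tsum_congr fun k => ?_
  have : (2 * k + 2 : ℝ) = ((2 * k + 1 : ℕ) : ℝ) + 1 := by push_cast; ring
  rw [regQ, this, regP_natCast_succ, tailProduct, sub_sub_cancel]

/-- The probability that two independent Poisson variables of mean `x` coincide. -/
noncomputable def poissonCollision (x : ℝ) : ℝ := ∑' n, poissonWeight x n ^ 2

lemma poissonWeight_le_one {x : ℝ} (hx : 0 ≤ x) (n : ℕ) : poissonWeight x n ≤ 1 :=
  le_hasSum (hasSum_poissonWeight x) n fun j _ => poissonWeight_nonneg hx j

lemma hasSum_poissonWeight_mul {x : ℝ} (hx : 0 ≤ x) :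
    HasSum (fun n => poissonWeight x n * (2 * poissonCDF x (n + 1) - 1)) (poissonCollision x) := by
  have hsq : Summable fun n => poissonWeight x n ^ 2 :=
    Summable.of_nonneg_of_le (fun n => sq_nonneg _) (fun n => by
      nlinarith [poissonWeight_nonneg hx n, poissonWeight_le_one hx n])
      (hasSum_poissonWeight x).summable
  have hsum : Summable fun n => poissonWeight x n * (2 * poissonCDF x (n + 1) - 1) := by
    refine Summable.of_norm_bounded (hasSum_poissonWeight x).summable fun n => ?_
    rw [norm_mul, Real.norm_of_nonneg (poissonWeight_nonneg hx n)]
    refine mul_le_of_le_one_right (poissonWeight_nonneg hx n) ?_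
    rw [Real.norm_eq_abs, abs_le]
    constructor <;> linarith [poissonCDF_nonneg hx (n + 1), poissonCDF_le_one hx (n + 1)]
  refine (hsum.hasSum_iff_tendsto_nat).2 ?_
  have key : ∀ N, ∑ n ∈ Finset.range N, poissonWeight x n * (2 * poissonCDF x (n + 1) - 1) =
      poissonCDF x N ^ 2 - poissonCDF x N + ∑ n ∈ Finset.range N, poissonWeight x n ^ 2 := by
    intro N
    induction N with
    | zero => simp [poissonCDF]
    | succ N ih => rw [Finset.sum_range_succ, ih, Finset.sum_range_succ, poissonCDF_succ]; ring
  simp_rw [key]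
  simpa [poissonCollision] using (((tendsto_poissonCDF x).pow 2).sub (tendsto_poissonCDF x)).add
    hsq.hasSum.tendsto_sum_nat

lemma tailProduct_eq_integral (x : ℝ) (n : ℕ) : tailProduct x n =
    ∫ t in (0:ℝ)..x, poissonWeight t n * (2 * poissonCDF t (n + 1) - 1) := by
  rw [intervalIntegral.integral_eq_sub_of_hasDerivAt (f := fun y => tailProduct y n)]
  · simp [tailProduct, poissonCDF_zero_left]
  · intro t _
    have h := hasDerivAt_poissonCDF n t
    exact ((h.const_sub 1).mul h).congr_deriv (by ring)
  · exact ((continuous_poissonWeight n).mul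
      (((continuous_poissonCDF (n + 1)).const_mul 2).sub continuous_const)).intervalIntegrable _ _

lemma hasSum_tailProduct {x : ℝ} (hx : 0 ≤ x) :
    HasSum (tailProduct x) (∫ t in (0:ℝ)..x, poissonCollision t) := by
  simp_rw [funext (tailProduct_eq_integral x)]
  refine intervalIntegral.hasSum_integral_of_dominated_convergence
    (fun n t => poissonWeight t n) (fun n => ?_) (fun n => ?_) ?_ ?_ ?_
  · exact ((continuous_poissonWeight n).mul (((continuous_poissonCDF (n + 1)).const_mul 2).sub
      continuous_const)).aestronglyMeasurable
  · refine ae_of_all _ fun t ht => ?_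
    rw [Set.uIoc_of_le hx] at ht
    have ht := ht.1.le
    rw [norm_mul, Real.norm_of_nonneg (poissonWeight_nonneg ht n)]
    refine mul_le_of_le_one_right (poissonWeight_nonneg ht n) ?_
    rw [Real.norm_eq_abs, abs_le]
    constructor <;> linarith [poissonCDF_nonneg ht (n + 1), poissonCDF_le_one ht (n + 1)]
  · exact ae_of_all _ fun t _ => (hasSum_poissonWeight t).summable
  · simp_rw [(hasSum_poissonWeight _).tsum_eq]
    exact intervalIntegrable_const
  · refine ae_of_all _ fun t ht => ?_
    rw [Set.uIoc_of_le hx] at ht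
    exact hasSum_poissonWeight_mul ht.1.le

/-- Summing over odd indices only gives half the full sum, up to a bounded error. -/
lemma abs_two_mul_tsum_tailProduct_odd_sub_le {x : ℝ} (hx : 0 ≤ x) :
    |2 * (∑' k : ℕ, tailProduct x (2 * k + 1)) - ∫ t in (0:ℝ)..x, poissonCollision t| ≤ 1 := by
  have hs := (hasSum_tailProduct hx).summable
  have he : Summable fun k : ℕ => tailProduct x (2 * k) :=
    hs.comp_injective fun a b h => by simpa using h
  have ho : Summable fun k : ℕ => tailProduct x (2 * k + 1) :=
    hs.comp_injective fun a b h => by simpa using h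
  have hw : Summable fun k : ℕ => poissonWeight x (2 * k + 1) :=
    (hasSum_poissonWeight x).summable.comp_injective fun a b h => by simpa using h
  rw [← (hasSum_tailProduct hx).tsum_eq, ← tsum_even_add_odd he ho, two_mul,
    add_sub_add_right_eq_sub, ← ho.tsum_sub he, ← Real.norm_eq_abs]
  calc ‖∑' k : ℕ, (tailProduct x (2 * k + 1) - tailProduct x (2 * k))‖
      ≤ ∑' k : ℕ, poissonWeight x (2 * k + 1) := by
        refine tsum_of_norm_bounded hw.hasSum fun k => ?_
        have h0 := poissonWeight_nonneg hx (2 * k + 1)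
        have h1 := poissonCDF_nonneg hx (2 * k + 1)
        have h2 := poissonCDF_le_one hx (2 * k + 1 + 1)
        rw [tailProduct, tailProduct, Real.norm_eq_abs, abs_le]
        rw [poissonCDF_succ] at h2 ⊢
        constructor <;> nlinarith
    _ ≤ ∑' n, poissonWeight x n :=
        hw.tsum_le_tsum_of_inj (fun k => 2 * k + 1) (fun a b h => by simpa using h)
          (fun n _ => poissonWeight_nonneg hx n) (fun _ => le_rfl)
          (hasSum_poissonWeight x).summable
    _ = 1 := (hasSum_poissonWeight x).tsum_eq

lemma prod_odd_div_even (n : ℕ) :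
    ∏ i ∈ Finset.range n, (2 * (i : ℝ) + 1) / (2 * i + 2) =
      (2 * n).factorial / (4 ^ n * (n.factorial : ℝ) ^ 2) := by
  induction n with
  | zero => simp
  | succ n ih =>
    rw [Finset.prod_range_succ, ih, show 2 * (n + 1) = 2 * n + 1 + 1 by ring,
      Nat.factorial_succ, Nat.factorial_succ, Nat.factorial_succ]
    have : (n.factorial : ℝ) ≠ 0 := by positivity
    push_cast
    field_simp
    ring

lemma hasSum_integral_cosh_mul_sin (y : ℝ) :
    HasSum (fun n : ℕ => π * (y ^ n / n.factorial) ^ 2)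
      (∫ θ in (0:ℝ)..π, cosh (2 * y * sin θ)) := by
  have h : HasSum (fun n : ℕ => ∫ θ in (0:ℝ)..π, (2 * y * sin θ) ^ (2 * n) / (2 * n).factorial)
      (∫ θ in (0:ℝ)..π, cosh (2 * y * sin θ)) := by
    refine intervalIntegral.hasSum_integral_of_dominated_convergence
      (fun n _ => (2 * y) ^ (2 * n) / (2 * n).factorial) (fun n => ?_) (fun n => ?_) ?_ ?_ ?_
    · exact Continuous.aestronglyMeasurable (by fun_prop)
    · refine ae_of_all _ fun θ _ => ?_
      rw [Real.norm_of_nonneg (div_nonneg (Even.pow_nonneg (even_two_mul n) _) (by positivity))]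
      gcongr ?_ / _
      rw [mul_pow]
      refine mul_le_of_le_one_right (Even.pow_nonneg (even_two_mul n) _) ?_
      rw [pow_mul]
      exact pow_le_one₀ (sq_nonneg _) (sin_sq_le_one θ)
    · exact ae_of_all _ fun θ _ => (Real.hasSum_cosh (2 * y)).summable
    · exact intervalIntegrable_const
    · exact ae_of_all _ fun θ _ => Real.hasSum_cosh _
  convert! h using 1
  funext n
  simp_rw [mul_pow (2 * y), mul_div_right_comm _ (_ ^ (2 * n))]
  rw [intervalIntegral.integral_const_mul, integral_sin_pow_even, prod_odd_div_even]
  have : (n.factorial : ℝ) ≠ 0 := by positivity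
  have : ((2 * n).factorial : ℝ) ≠ 0 := by positivity
  rw [mul_pow, pow_mul 2, pow_mul y, pow_right_comm y, show (2 : ℝ) ^ 2 = 4 by norm_num]
  field_simp

lemma poissonCollision_eq_integral (y : ℝ) : poissonCollision y =
    π⁻¹ * ∫ φ in -(π / 2)..π / 2, exp (-(2 * y)) * cosh (2 * y * cos φ) := by
  have h := (hasSum_integral_cosh_mul_sin y).mul_left (π⁻¹ * exp (-(2 * y)))
  have h2 : ∫ φ in -(π / 2)..π / 2, cosh (2 * y * cos φ) =
      ∫ θ in (0:ℝ)..π, cosh (2 * y * sin θ) := by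
    have := intervalIntegral.integral_comp_add_right (a := -(π / 2)) (b := π / 2)
      (fun θ => cosh (2 * y * sin θ)) (π / 2)
    simpa [sin_add_pi_div_two] using this
  rw [intervalIntegral.integral_const_mul, h2, ← mul_assoc, ← h.tsum_eq, poissonCollision]
  refine tsum_congr fun n => ?_
  rw [poissonWeight, mul_pow, ← Real.exp_nat_mul]
  field_simp
  push_cast
  ring_nf

lemma continuous_poissonCollision : Continuous poissonCollision := by
  simp_rw [funext poissonCollision_eq_integral]
  refine continuous_const.mul ?_
  apply intervalIntegral.continuous_parametric_intervalIntegral_of_continuous'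
  unfold Function.uncurry
  fun_prop

/-- The integrand of `poissonCollision`, rescaled by `√y`. -/
noncomputable def collisionKernel (y u : ℝ) : ℝ :=
  (Set.Ioc (-(π / 2 * √y)) (π / 2 * √y)).indicator
    (fun u => exp (-(2 * y)) * cosh (2 * y * cos (u / √y))) u

lemma sqrt_mul_poissonCollision {y : ℝ} (hy : 0 < y) :
    √y * poissonCollision y = π⁻¹ * ∫ u, collisionKernel y u := by
  have hs : √y ≠ 0 := (Real.sqrt_pos.2 hy).ne'
  have hp : 0 < √y := Real.sqrt_pos.2 hy
  have h := intervalIntegral.integral_comp_div (a := -(π / 2 * √y)) (b := π / 2 * √y)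
    (fun φ => exp (-(2 * y)) * cosh (2 * y * cos φ)) hs
  rw [neg_div, mul_div_cancel_right₀ _ hs,
    intervalIntegral.integral_of_le (by linarith [mul_pos pi_div_two_pos hp]),
    ← integral_indicator measurableSet_Ioc, smul_eq_mul] at h
  simp_rw [collisionKernel]
  rw [h, poissonCollision_eq_integral]
  ring

lemma collisionKernel_nonneg (y u : ℝ) : 0 ≤ collisionKernel y u :=
  Set.indicator_nonneg (fun _ _ => mul_nonneg (exp_pos _).le (cosh_pos _).le) _

lemma collisionKernel_le {y : ℝ} (hy : 0 < y) (u : ℝ) :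
    collisionKernel y u ≤ exp (-(4 / π ^ 2) * u ^ 2) := by
  refine Set.indicator_apply_le' (fun hu => ?_) fun _ => (exp_pos _).le
  have hp : 0 < √y := Real.sqrt_pos.2 hy
  have hu : |u / √y| ≤ π / 2 := by
    rw [abs_div, abs_of_pos hp, div_le_iff₀ hp, abs_le]
    exact ⟨hu.1.le, hu.2⟩
  have hc : 0 ≤ cos (u / √y) := cos_nonneg_of_mem_Icc (abs_le.1 hu)
  have hq := cos_le_one_sub_mul_cos_sq (hu.trans (by linarith [pi_pos]))
  have hz : cosh (2 * y * cos (u / √y)) ≤ exp (2 * y * cos (u / √y)) := by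
    have : exp (-(2 * y * cos (u / √y))) ≤ exp (2 * y * cos (u / √y)) :=
      exp_le_exp.2 (neg_le_self (by positivity))
    rw [cosh_eq]
    linarith
  calc exp (-(2 * y)) * cosh (2 * y * cos (u / √y))
      ≤ exp (-(2 * y)) * exp (2 * y * cos (u / √y)) := by gcongr
    _ = exp (-(2 * y) + 2 * y * cos (u / √y)) := (Real.exp_add _ _).symm
    _ ≤ _ := by
      refine exp_le_exp.2 ?_
      have h1 := mul_le_mul_of_nonneg_left hq (by positivity : 0 ≤ 2 * y)
      have h2 : 2 * y * (1 - 2 / π ^ 2 * (u / √y) ^ 2) = 2 * y - 4 / π ^ 2 * u ^ 2 := by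
        rw [div_pow, Real.sq_sqrt hy.le]
        field_simp
        ring
      linarith

lemma tendsto_mul_one_sub_cos_div_sqrt (u : ℝ) :
    Tendsto (fun y : ℝ => 2 * y * (1 - cos (u / √y))) atTop (nhds (u ^ 2)) := by
  have h : Tendsto (fun y : ℝ => u ^ 2 * sinc (u / 2 / √y) ^ 2) atTop (nhds (u ^ 2)) := by
    have h0 : Tendsto (fun y : ℝ => u / 2 / √y) atTop (nhds 0) :=
      tendsto_const_nhds.div_atTop tendsto_sqrt_atTop
    have h1 := (continuous_sinc.tendsto 0).comp h0
    rw [sinc_zero] at h1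
    simpa using (h1.pow 2).const_mul (u ^ 2)
  refine h.congr' ?_
  filter_upwards [eventually_gt_atTop 0] with y hy
  have hp : 0 < √y := Real.sqrt_pos.2 hy
  rcases eq_or_ne u 0 with rfl | hu
  · simp
  have h2 : u / √y = 2 * (u / 2 / √y) := by ring
  rw [sinc_of_ne_zero (by positivity), h2, cos_two_mul, cos_sq', div_pow, div_pow,
    Real.sq_sqrt hy.le]
  field_simp
  ring

lemma tendsto_collisionKernel (u : ℝ) :
    Tendsto (fun y => collisionKernel y u) atTop (nhds (exp (-1 * u ^ 2) / 2)) := by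
  have h1 := tendsto_mul_one_sub_cos_div_sqrt u
  have h2 : Tendsto (fun y : ℝ => 4 * y - 2 * y * (1 - cos (u / √y))) atTop atTop :=
    (tendsto_id.const_mul_atTop (by norm_num : (0:ℝ) < 4)).atTop_add h1.neg
  have h3 := ((((Real.continuous_exp.tendsto _).comp h1.neg)).add
    (tendsto_exp_neg_atTop_nhds_zero.comp h2)).div_const 2
  rw [add_zero, neg_eq_neg_one_mul] at h3
  refine h3.congr' ?_
  have h4 := tendsto_sqrt_atTop.const_mul_atTop pi_div_two_pos
  filter_upwards [h4.eventually_gt_atTop |u|] with y hy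
  have hy := abs_lt.1 hy
  rw [collisionKernel, Set.indicator_of_mem (Set.mem_Ioc.2 ⟨hy.1, hy.2.le⟩), cosh_eq, mul_div_assoc', mul_add,
    ← Real.exp_add, ← Real.exp_add]
  simp only [Function.comp_apply]
  ring_nf

lemma integrable_gaussian_bound : Integrable fun u : ℝ => exp (-(4 / π ^ 2) * u ^ 2) :=
  integrable_exp_neg_mul_sq (by positivity)

lemma aestronglyMeasurable_collisionKernel (y : ℝ) :
    AEStronglyMeasurable (collisionKernel y) :=
  (Continuous.aestronglyMeasurable (by fun_prop)).indicator measurableSet_Ioc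

lemma tendsto_sqrt_mul_poissonCollision :
    Tendsto (fun y => √y * poissonCollision y) atTop (nhds (1 / (2 * √π))) := by
  have h : Tendsto (fun y => π⁻¹ * ∫ u, collisionKernel y u) atTop
      (nhds (π⁻¹ * ∫ u, exp (-1 * u ^ 2) / 2)) := by
    refine Tendsto.const_mul _ (tendsto_integral_filter_of_dominated_convergence _
      (.of_forall aestronglyMeasurable_collisionKernel) ?_ integrable_gaussian_bound
      (ae_of_all _ tendsto_collisionKernel))
    filter_upwards [eventually_gt_atTop 0] with y hy
    refine ae_of_all _ fun u => ?_
    rw [Real.norm_of_nonneg (collisionKernel_nonneg y u)]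
    exact collisionKernel_le hy u
  rw [integral_div, integral_gaussian, div_one] at h
  have h5 : π⁻¹ * (√π / 2) = 1 / (2 * √π) := by
    have : √π ≠ 0 := (Real.sqrt_pos.2 pi_pos).ne'
    field_simp
    exact Real.sq_sqrt pi_pos.le
  rw [h5] at h
  refine h.congr' ?_
  filter_upwards [eventually_gt_atTop 0] with y hy
  exact (sqrt_mul_poissonCollision hy).symm

lemma exists_sqrt_mul_poissonCollision_le :
    ∃ C, ∀ y, 0 < y → √y * poissonCollision y ≤ C := by
  refine ⟨π⁻¹ * ∫ u, exp (-(4 / π ^ 2) * u ^ 2), fun y hy => ?_⟩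
  rw [sqrt_mul_poissonCollision hy]
  refine mul_le_mul_of_nonneg_left ?_ (inv_nonneg.2 pi_pos.le)
  exact integral_mono_of_nonneg (ae_of_all _ (collisionKernel_nonneg y)) integrable_gaussian_bound
    (ae_of_all _ (collisionKernel_le hy))

lemma poissonCollision_nonneg (y : ℝ) : 0 ≤ poissonCollision y :=
  tsum_nonneg fun _ => sq_nonneg _

lemma tendsto_integral_poissonCollision_div_sqrt :
    Tendsto (fun x => (∫ t in (0:ℝ)..x, poissonCollision t) / √x) atTop (nhds (1 / √π)) := by
  obtain ⟨C, hC⟩ := exists_sqrt_mul_poissonCollision_le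
  have h : Tendsto (fun x => ∫ s in (0:ℝ)..1, √x * poissonCollision (x * s)) atTop
      (nhds (∫ s in (0:ℝ)..1, 1 / (2 * √π) * s ^ (-(1 / 2) : ℝ))) := by
    have hrpow : ∀ s : ℝ, 0 < s → s ^ (-(1 / 2) : ℝ) = (√s)⁻¹ := fun s hs => by
      rw [Real.rpow_neg hs.le, Real.sqrt_eq_rpow]
    have hscale : ∀ x s : ℝ, 0 < x → 0 < s → √x * poissonCollision (x * s) =
        √(x * s) * poissonCollision (x * s) * s ^ (-(1 / 2) : ℝ) := fun x s hx hs => by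
      have : √s ≠ 0 := (Real.sqrt_pos.2 hs).ne'
      rw [hrpow s hs, Real.sqrt_mul hx.le]
      field_simp
    refine intervalIntegral.tendsto_integral_filter_of_dominated_convergence
      (fun s => C * s ^ (-(1 / 2) : ℝ)) ?_ ?_ ?_ ?_
    · exact .of_forall fun x => (continuous_const.mul (continuous_poissonCollision.comp
        (continuous_const.mul continuous_id))).aestronglyMeasurable
    · filter_upwards [eventually_gt_atTop 0] with x hx
      refine ae_of_all _ fun s hs => ?_
      rw [Set.uIoc_of_le zero_le_one] at hs
      rw [Real.norm_of_nonneg (mul_nonneg (Real.sqrt_nonneg _) (poissonCollision_nonneg _)),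
        hscale x s hx hs.1]
      exact mul_le_mul_of_nonneg_right (hC _ (mul_pos hx hs.1)) (Real.rpow_nonneg hs.1.le _)
    · exact (intervalIntegral.intervalIntegrable_rpow' (by norm_num)).const_mul C
    · refine ae_of_all _ fun s hs => ?_
      rw [Set.uIoc_of_le zero_le_one] at hs
      have h1 := (tendsto_sqrt_mul_poissonCollision.comp
        (tendsto_id.atTop_mul_const hs.1)).mul_const (s ^ (-(1 / 2) : ℝ))
      refine h1.congr' ?_
      filter_upwards [eventually_gt_atTop 0] with x hx
      exact (hscale x s hx hs.1).symm
  rw [intervalIntegral.integral_const_mul, integral_rpow (.inl (by norm_num))] at h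
  have h5 : 1 / (2 * √π) * (((1:ℝ) ^ (-(1 / 2) + 1 : ℝ) - 0 ^ (-(1 / 2) + 1 : ℝ)) /
      (-(1 / 2) + 1)) = 1 / √π := by
    rw [Real.one_rpow, Real.zero_rpow (by norm_num)]
    field_simp
    norm_num
  rw [h5] at h
  refine h.congr' ?_
  filter_upwards [eventually_gt_atTop 0] with x hx
  have hp : √x ≠ 0 := (Real.sqrt_pos.2 hx).ne'
  rw [intervalIntegral.integral_const_mul, intervalIntegral.integral_comp_mul_left _ hx.ne',
    mul_zero, mul_one, smul_eq_mul, eq_div_iff hp]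
  nth_rewrite 2 [← Real.sq_sqrt hx.le]
  field_simp

lemma tendsto_varGinSE_div_atTop :
    Tendsto (fun R : ℝ => varGinSE R / R) atTop (nhds (1 / √(2 * π))) := by
  have hx : Tendsto (fun R : ℝ => 2 * R ^ 2) atTop atTop :=
    (tendsto_pow_atTop two_ne_zero).const_mul_atTop two_pos
  have h1 := (tendsto_integral_poissonCollision_div_sqrt.comp hx).const_mul (√2 / 2)
  have h2 : Tendsto (fun R : ℝ => (2 * varGinSE R -
      ∫ t in (0:ℝ)..2 * R ^ 2, poissonCollision t) / R / 2) atTop (nhds 0) := by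
    refine squeeze_zero_norm' ?_ tendsto_inv_atTop_zero
    filter_upwards [eventually_gt_atTop 0] with R hR
    have := abs_two_mul_tsum_tailProduct_odd_sub_le (x := 2 * R ^ 2) (by positivity)
    rw [← varGinSE_eq] at this
    rw [norm_div, norm_div, Real.norm_of_nonneg hR.le, Real.norm_ofNat, Real.norm_eq_abs,
      div_div, div_le_iff₀ (by positivity)]
    field_simp
    linarith
  have h3 := h1.add h2
  have h5 : √2 / 2 * (1 / √π) + 0 = 1 / √(2 * π) := by
    have : √π ≠ 0 := (Real.sqrt_pos.2 pi_pos).ne'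
    rw [Real.sqrt_mul zero_le_two]
    field_simp
    simp
  rw [h5] at h3
  refine h3.congr' ?_
  filter_upwards [eventually_gt_atTop 0] with R hR
  simp only [Function.comp_apply]
  rw [Real.sqrt_mul zero_le_two, Real.sqrt_sq hR.le]
  field_simp
  ring

lemma one_sub_poissonCDF_le {x : ℝ} (hx : 0 ≤ x) (n : ℕ) :
    1 - poissonCDF x (n + 1) ≤ x ^ (n + 1) / (n + 1).factorial := by
  rw [← integral_poissonWeight]
  calc ∫ t in (0:ℝ)..x, poissonWeight t n ≤ ∫ t in (0:ℝ)..x, t ^ n / n.factorial := by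
        refine intervalIntegral.integral_mono_on hx
          ((continuous_poissonWeight n).intervalIntegrable _ _)
          (Continuous.intervalIntegrable (by fun_prop) _ _) fun t ht => ?_
        exact mul_le_of_le_one_left (div_nonneg (pow_nonneg ht.1 n) (by positivity))
          (exp_le_one_iff.2 (neg_nonpos.2 ht.1))
    _ = x ^ (n + 1) / (n + 1).factorial := by
      rw [intervalIntegral.integral_div, integral_pow, Nat.factorial_succ]
      push_cast
      field_simp
      simp

lemma poissonWeight_le_one_sub_poissonCDF {x : ℝ} (hx : 0 ≤ x) (n : ℕ) :
    poissonWeight x n ≤ 1 - poissonCDF x n := by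
  have := poissonCDF_le_one hx (n + 1)
  rw [poissonCDF_succ] at this
  linarith

lemma tailProduct_nonneg {x : ℝ} (hx : 0 ≤ x) (n : ℕ) : 0 ≤ tailProduct x n :=
  mul_nonneg (sub_nonneg.2 (poissonCDF_le_one hx _)) (poissonCDF_nonneg hx _)

lemma tailProduct_le {x : ℝ} (hx : 0 ≤ x) (n : ℕ) :
    tailProduct x n ≤ x ^ (n + 1) / (n + 1).factorial :=
  (mul_le_of_le_one_right (sub_nonneg.2 (poissonCDF_le_one hx _)) (poissonCDF_le_one hx _)).trans
    (one_sub_poissonCDF_le hx n)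

lemma tendsto_tailProduct_one_div_sq :
    Tendsto (fun x => tailProduct x 1 / x ^ 2) (nhdsWithin 0 (Set.Ioi 0)) (nhds (1 / 2)) := by
  have hF : Tendsto (fun x => poissonCDF x 2) (nhdsWithin 0 (Set.Ioi 0)) (nhds 1) := by
    have := (continuous_poissonCDF 2).tendsto 0
    rw [poissonCDF_zero_left] at this
    exact this.mono_left nhdsWithin_le_nhds
  have hP : Tendsto (fun x => (1 - poissonCDF x 2) / x ^ 2) (nhdsWithin 0 (Set.Ioi 0))
      (nhds (1 / 2)) := by
    have he : Tendsto (fun x : ℝ => exp (-x) / 2) (nhdsWithin 0 (Set.Ioi 0)) (nhds (1 / 2)) := by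
      have : Continuous fun x : ℝ => exp (-x) / 2 := by fun_prop
      simpa using (this.tendsto 0).mono_left nhdsWithin_le_nhds
    refine tendsto_of_tendsto_of_tendsto_of_le_of_le' he tendsto_const_nhds ?_ ?_
    · filter_upwards [self_mem_nhdsWithin] with x hx
      have hx : 0 < x := hx
      have := poissonWeight_le_one_sub_poissonCDF hx.le 2
      rw [le_div_iff₀ (by positivity)]
      refine le_trans (le_of_eq ?_) this
      simp [poissonWeight]
      ring
    · filter_upwards [self_mem_nhdsWithin] with x hx
      have hx : 0 < x := hx
      have := one_sub_poissonCDF_le hx.le 1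
      rw [div_le_iff₀ (by positivity)]
      refine this.trans (le_of_eq ?_)
      simp
      ring
  have h := hP.mul hF
  rw [mul_one] at h
  exact h.congr fun x => by rw [tailProduct]; ring

lemma tendsto_tsum_tailProduct_odd_div_sq :
    Tendsto (fun x => (∑' k : ℕ, tailProduct x (2 * k + 1)) / x ^ 2) (nhdsWithin 0 (Set.Ioi 0))
      (nhds (1 / 2)) := by
  have hdiv : ∀ x : ℝ, 0 < x → ∀ k : ℕ, ‖tailProduct x (2 * k + 1) / x ^ 2‖ ≤
      x ^ (2 * k) / (2 * k + 1 + 1).factorial := fun x hx k => by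
    rw [Real.norm_of_nonneg (div_nonneg (tailProduct_nonneg hx.le _) (sq_nonneg x)),
      div_le_iff₀ (by positivity)]
    refine (tailProduct_le hx.le _).trans (le_of_eq ?_)
    ring
  have hsum : Summable fun k : ℕ => 1 / ((2 * k + 1 + 1).factorial : ℝ) := by
    have := (NormedSpace.expSeries_div_hasSum_exp (1 : ℝ)).summable
    simpa [Function.comp_def] using this.comp_injective (i := fun k : ℕ => 2 * k + 1 + 1)
      fun a b h => by simpa using h
  have h := tendsto_tsum_of_dominated_convergence (𝓕 := nhdsWithin (0 : ℝ) (Set.Ioi 0))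
    (f := fun x (k : ℕ) => tailProduct x (2 * k + 1) / x ^ 2)
    (g := fun k => if k = 0 then 1 / 2 else 0) hsum (fun k => ?_) ?_
  · simpa only [tsum_ite_eq, tsum_div_const] using h
  · split_ifs with hk
    · simpa [hk] using tendsto_tailProduct_one_div_sq
    · have h0 : Tendsto (fun x : ℝ => x ^ (2 * k) / (2 * k + 1 + 1).factorial)
          (nhdsWithin 0 (Set.Ioi 0)) (nhds 0) := by
        have : Continuous fun x : ℝ => x ^ (2 * k) / (2 * k + 1 + 1).factorial := by fun_prop
        simpa [hk] using (this.tendsto 0).mono_left nhdsWithin_le_nhds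
      refine squeeze_zero_norm' ?_ h0
      filter_upwards [self_mem_nhdsWithin] with x hx using hdiv x hx k
  · filter_upwards [Ioo_mem_nhdsGT (zero_lt_one' ℝ)] with x hx k
    refine (hdiv x hx.1 k).trans ?_
    gcongr
    exact pow_le_one₀ hx.1.le hx.2.le

lemma tendsto_varGinSE_div_pow_four :
    Tendsto (fun R : ℝ => varGinSE R / R ^ 4) (nhdsWithin 0 (Set.Ioi 0)) (nhds 2) := by
  have hx : Tendsto (fun R : ℝ => 2 * R ^ 2) (nhdsWithin 0 (Set.Ioi 0))
      (nhdsWithin 0 (Set.Ioi 0)) := by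
    refine tendsto_nhdsWithin_iff.2 ⟨?_, ?_⟩
    · have : Continuous fun R : ℝ => 2 * R ^ 2 := by fun_prop
      simpa using (this.tendsto 0).mono_left nhdsWithin_le_nhds
    · filter_upwards [self_mem_nhdsWithin] with R hR
      have hR : 0 < R := hR
      exact Set.mem_Ioi.2 (by positivity)
  have h := (tendsto_tsum_tailProduct_odd_div_sq.comp hx).const_mul 4
  norm_num at h
  refine h.congr fun R => ?_
  rw [varGinSE_eq]
  field_simp
  ring

theorem number_variance_GinSE_asymptotics :
    Tendsto (fun R : ℝ => varGinSE R / R) atTop (nhds (1 / Real.sqrt (2 * π))) ∧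
    Tendsto (fun R : ℝ => varGinSE R / R ^ 4) (nhdsWithin 0 (Set.Ioi 0)) (nhds 2) :=
  ⟨tendsto_varGinSE_div_atTop, tendsto_varGinSE_div_pow_four⟩
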